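/- arXiv:2110.11028 — 13 statements merged into one kernel-verified Lean document; each statement's English description precedes it below -/
import Mathlib

section
/- The operation ∘ is associative; more precisely, for all g, h, k ∈ G both (g ∘ h) ∘ k and g ∘ (h ∘ k) are equal to g · ψ↑(g) · h · ψ↑(h) · k · ψ↑(h)⁻¹ · ψ↑(g)⁻¹ · α(g,h) · α(g,k) · α(h,k). -/
/-- A map multiplicative on `G` with central values that kills `K` takes the same value on
`g * x * h * x⁻¹ * z`, for `z ∈ K`, as on `g * h`. -/
theorem map_mul_conj_mul_of_central {G : Type*} [Group G] {K : Subgroup G} {f : G → G}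
    (hmul : ∀ a b, f (a * b) = f a * f b) (hcentral : ∀ a b, f a * b = b * f a)
    (hK : ∀ z ∈ K, f z = 1) (g x h : G) {z : G} (hz : z ∈ K) :
    f (g * x * h * x⁻¹ * z) = f g * f h := by
  have hx : f x * f x⁻¹ = 1 := by
    rw [← hmul, mul_inv_cancel, hK 1 K.one_mem]
  rw [hmul, hmul, hmul, hmul, hK z hz, mul_one, mul_assoc (f g), hcentral x (f h),
    mul_assoc, mul_assoc, hx, mul_one]

/-- A lifting of an endomorphism of `G ⧸ K` with values in a subgroup that is abelian modulo `K`
sends `g * l g * h * (l g)⁻¹ * z`, for `z ∈ K`, to `l g * l h` up to a factor in `K`. -/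
theorem exists_lift_mul_conj_eq {G : Type*} [Group G] {K A : Subgroup G} [K.Normal]
    (hAK : ∀ a ∈ A, ∀ b ∈ A, a * b * a⁻¹ * b⁻¹ ∈ K) (ψ : G ⧸ K →* G ⧸ K)
    {l : G → G} (hlA : ∀ g, l g ∈ A)
    (hl : ∀ g : G, (QuotientGroup.mk (l g) : G ⧸ K) = ψ (QuotientGroup.mk g))
    (g h : G) {z : G} (hz : z ∈ K) :
    ∃ c ∈ K, l (g * l g * h * (l g)⁻¹ * z) = l g * l h * c := by
  have hcomm : ψ (l g : G ⧸ K) * ψ (h : G ⧸ K) * (ψ (l g : G ⧸ K))⁻¹ = ψ (h : G ⧸ K) := by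
    have := (QuotientGroup.eq_one_iff _).2 (hAK _ (hlA (l g)) _ (hlA h))
    simp only [QuotientGroup.mk_mul, QuotientGroup.mk_inv] at this
    rw [hl (l g), hl h, hl g] at this
    rw [hl g]
    exact mul_inv_eq_one.1 this
  have hquot : ((l g * l h : G) : G ⧸ K) = l (g * l g * h * (l g)⁻¹ * z) := by
    rw [hl (g * l g * h * (l g)⁻¹ * z), QuotientGroup.mk_mul, hl g, hl h]
    simp only [QuotientGroup.mk_mul, QuotientGroup.mk_inv, map_mul, map_inv,
      (QuotientGroup.eq_one_iff z).2 hz, mul_one]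
    rw [mul_assoc (ψ (g : G ⧸ K)), mul_assoc (ψ (g : G ⧸ K)), hcomm]
  exact ⟨_, QuotientGroup.eq.1 hquot, (mul_inv_cancel_left _ _).symm⟩

/-- The operation `∘` is associative, with both associations equal to the stated product. -/
theorem stmt_1
    {G : Type*} [Group G] (K A : Subgroup G) [K.Normal]
    (hKZ : K ≤ Subgroup.center G) (hKA : K ≤ A)
    (hAK : ∀ a ∈ A, ∀ b ∈ A, a * b * a⁻¹ * b⁻¹ ∈ K)
    (ψ : G ⧸ K →* G ⧸ K)
    (hψA : ∀ x : G ⧸ K, ψ x ∈ Subgroup.map (QuotientGroup.mk' K) A)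
    (l : G → G) (hlA : ∀ g, l g ∈ A)
    (hl : ∀ g : G, (QuotientGroup.mk (l g) : G ⧸ K) = ψ (QuotientGroup.mk g))
    (α : G → G → G) (hαK : ∀ g h, α g h ∈ K)
    (hαmul₁ : ∀ g h k : G, α (g * h) k = α g k * α h k)
    (hαmul₂ : ∀ g h k : G, α g (h * k) = α g h * α g k)
    (hαK₁ : ∀ g : G, ∀ k ∈ K, α k g = 1)
    (hαK₂ : ∀ g : G, ∀ k ∈ K, α g k = 1)
    (circ : G → G → G)
    (hcirc : ∀ g h : G, circ g h = g * l g * h * (l g)⁻¹ * α g h)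
    :
    ∀ g h k : G,
      circ (circ g h) k =
        g * l g * h * l h * k * (l h)⁻¹ * (l g)⁻¹ * α g h * α g k * α h k ∧
      circ g (circ h k) =
        g * l g * h * l h * k * (l h)⁻¹ * (l g)⁻¹ * α g h * α g k * α h k := by
  intro g h k
  have hcen : ∀ z ∈ K, ∀ w, z * w = w * z := fun z hz w =>
    (Subgroup.mem_center_iff.1 (hKZ hz) w).symm
  have hα : ∀ a b w, α a b * w = w * α a b := fun a b => hcen _ (hαK a b)
  have hα₁ : α (circ g h) k = α g k * α h k := by
    rw [hcirc]
    exact map_mul_conj_mul_of_central (f := fun a => α a k) (fun a b => hαmul₁ a b k)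
      (fun a => hα a k) (hαK₁ k) g (l g) h (hαK g h)
  have hα₂ : α g (circ h k) = α g h * α g k := by
    rw [hcirc]
    exact map_mul_conj_mul_of_central (hαmul₂ g) (hα g) (hαK₂ g) h (l h) k (hαK h k)
  constructor
  · obtain ⟨c, hc, hlc⟩ := exists_lift_mul_conj_eq hAK ψ hlA hl g h (hαK g h)
    have hconj : l (circ g h) * k * (l (circ g h))⁻¹ = l g * l h * k * (l h)⁻¹ * (l g)⁻¹ := by
      rw [hcirc, hlc, mul_assoc (l g * l h), hcen c hc k]
      group
    calc circ (circ g h) k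
        = circ g h * (l (circ g h) * k * (l (circ g h))⁻¹) * α (circ g h) k := by
          rw [hcirc (circ g h) k]; group
      _ = g * l g * h * (l g)⁻¹ * (α g h * (l g * l h * k * (l h)⁻¹ * (l g)⁻¹)) *
            (α g k * α h k) := by
          rw [hconj, hα₁, hcirc g h]; group
      _ = _ := by
          rw [hα g h]; group
  · calc circ g (circ h k)
        = g * l g * h * l h * k * (l h)⁻¹ * (α h k * ((l g)⁻¹ * α g h * α g k)) := by
          rw [hcirc g (circ h k), hα₂, hcirc h k]; group
      _ = _ := by
          rw [hα h k]; group
end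

section
/- The element 1 is a two-sided identity for ∘ (i.e. 1 ∘ g = g = g ∘ 1 for all g ∈ G), and for every g ∈ G the element ḡ = ψ↑(g)⁻¹ · g⁻¹ · ψ↑(g) · α(g,g) is a two-sided inverse of g with respect to ∘, i.e. g ∘ ḡ = 1 = ḡ ∘ g. -/
/-- `1` is a two-sided identity for `∘`, and `(l g)⁻¹ * g⁻¹ * l g * α g g` is a two-sided
inverse of `g` with respect to `∘`. -/
theorem stmt_2
    {G : Type*} [Group G] (K A : Subgroup G) [K.Normal]
    (hKZ : K ≤ Subgroup.center G) (hKA : K ≤ A)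
    (hAK : ∀ a ∈ A, ∀ b ∈ A, a * b * a⁻¹ * b⁻¹ ∈ K)
    (ψ : G ⧸ K →* G ⧸ K)
    (hψA : ∀ x : G ⧸ K, ψ x ∈ Subgroup.map (QuotientGroup.mk' K) A)
    (l : G → G) (hlA : ∀ g, l g ∈ A)
    (hl : ∀ g : G, (QuotientGroup.mk (l g) : G ⧸ K) = ψ (QuotientGroup.mk g))
    (α : G → G → G) (hαK : ∀ g h, α g h ∈ K)
    (hαmul₁ : ∀ g h k : G, α (g * h) k = α g k * α h k)
    (hαmul₂ : ∀ g h k : G, α g (h * k) = α g h * α g k)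
    (hαK₁ : ∀ g : G, ∀ k ∈ K, α k g = 1)
    (hαK₂ : ∀ g : G, ∀ k ∈ K, α g k = 1)
    (circ : G → G → G)
    (hcirc : ∀ g h : G, circ g h = g * l g * h * (l g)⁻¹ * α g h)
    :
    (∀ g : G, circ 1 g = g ∧ circ g 1 = g) ∧
    (∀ g : G,
      circ g ((l g)⁻¹ * g⁻¹ * l g * α g g) = 1 ∧
      circ ((l g)⁻¹ * g⁻¹ * l g * α g g) g = 1) := by
  have comm_of_mem : ∀ k ∈ K, ∀ x : G, x * k = k * x := fun k hk x =>
    Subgroup.mem_center_iff.mp (hKZ hk) x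
  have α_inv_left : ∀ g k, α g⁻¹ k = (α g k)⁻¹ := fun g k =>
    eq_inv_of_mul_eq_one_left (by rw [← hαmul₁, inv_mul_cancel, hαK₁ k 1 K.one_mem])
  have α_inv_right : ∀ g k, α g k⁻¹ = (α g k)⁻¹ := fun g k =>
    eq_inv_of_mul_eq_one_left (by rw [← hαmul₂, inv_mul_cancel, hαK₂ g 1 K.one_mem])
  have ψ_comm : ∀ g h : G, Commute (ψ (g : G ⧸ K)) (ψ (h : G ⧸ K)) := fun g h => by
    have h1 := (QuotientGroup.eq_one_iff _).mpr (hAK (l g) (hlA g) (l h) (hlA h))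
    rw [QuotientGroup.mk_mul, QuotientGroup.mk_mul, QuotientGroup.mk_mul, QuotientGroup.mk_inv,
      QuotientGroup.mk_inv, hl, hl, mul_inv_eq_one, mul_inv_eq_iff_eq_mul] at h1
    exact h1
  refine ⟨fun g => ⟨?_, ?_⟩, fun g => ⟨?_, ?_⟩⟩
  · have hl_one : l 1 ∈ K := by
      rw [← QuotientGroup.eq_one_iff, hl, QuotientGroup.mk_one, map_one]
    rw [hcirc, hαK₁ g 1 K.one_mem, one_mul, mul_one, ← comm_of_mem _ hl_one g,
      mul_inv_cancel_right]
  · rw [hcirc, hαK₂ g 1 K.one_mem, mul_one, mul_one, mul_inv_cancel_right]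
  · have hα : α g ((l g)⁻¹ * g⁻¹ * l g * α g g) = (α g g)⁻¹ := by
      rw [hαmul₂, hαmul₂, hαmul₂, hαK₂ g _ (hαK g g), α_inv_right, α_inv_right, mul_one,
        comm_of_mem _ (hαK g (l g)), mul_inv_cancel_left]
    rw [hcirc, hα, comm_of_mem _ (hαK g g) ((l g)⁻¹ * g⁻¹ * l g), ← mul_assoc,
      comm_of_mem _ (hαK g g) (g * l g)]
    group
  · set b := (l g)⁻¹ * g⁻¹ * l g * α g g with hb
    have hα : α b g = (α g g)⁻¹ := by
      rw [hb, hαmul₁, hαmul₁, hαmul₁, hαK₁ g _ (hαK g g), α_inv_left, α_inv_left, mul_one,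
        comm_of_mem _ (hαK (l g) g), mul_inv_cancel_left]
    have hlb : l b * l g ∈ K := by
      rw [← QuotientGroup.eq_one_iff, QuotientGroup.mk_mul, hl, hl, hb, QuotientGroup.mk_mul,
        (QuotientGroup.eq_one_iff _).mpr (hαK g g), mul_one, QuotientGroup.mk_mul,
        QuotientGroup.mk_mul, QuotientGroup.mk_inv, QuotientGroup.mk_inv, map_mul, map_mul,
        map_inv, map_inv, mul_assoc, mul_assoc, (ψ_comm (l g) g).eq, inv_mul_cancel_left,
        inv_mul_cancel]
    have conj_l : l b * g * (l b)⁻¹ = (l g)⁻¹ * g * l g := by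
      have hlb' : l b = (l b * l g) * (l g)⁻¹ := (mul_inv_cancel_right _ _).symm
      generalize l b * l g = k at hlb hlb'
      rw [hlb', ← comm_of_mem k hlb]
      have h2 := comm_of_mem k hlb g
      calc (l g)⁻¹ * k * g * ((l g)⁻¹ * k)⁻¹ = (l g)⁻¹ * (k * g) * k⁻¹ * l g := by group
        _ = (l g)⁻¹ * g * l g := by rw [← h2]; group
    calc circ b g = b * (l b * g * (l b)⁻¹) * (α g g)⁻¹ := by
          rw [hcirc, hα]; simp only [mul_assoc]
      _ = 1 := by
          rw [conj_l, hb, mul_assoc _ (α g g), ← comm_of_mem _ (hαK g g)]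
          group
end

section
/- (Main Theorem) The triple (G, ∘_{φ,β}, ∘_{ψ,α}) is a skew brace: for all g, h, k ∈ G, g ∘_{ψ,α} (h ∘_{φ,β} k) = ((g ∘_{ψ,α} h) ∘_{φ,β} ḡ) ∘_{φ,β} (g ∘_{ψ,α} k), where ḡ = φ↑(g)⁻¹ · g⁻¹ · φ↑(g) · β(g,g) is the inverse of g with respect to ∘_{φ,β}. (By symmetry in the two pairs, (G, ∘_{ψ,α}, ∘_{φ,β}) is also a skew brace, so this is a bi-skew brace.) -/
/-- Elements that agree modulo a central subgroup induce the same inner automorphism. -/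
theorem conj_eq_of_mk_eq {G : Type*} [Group G] {K : Subgroup G} (hKZ : K ≤ Subgroup.center G)
    {a b : G} (hab : (QuotientGroup.mk a : G ⧸ K) = QuotientGroup.mk b) :
    MulAut.conj a = MulAut.conj b := by
  have hz := Subgroup.mem_center_iff.mp (hKZ (QuotientGroup.eq.mp hab))
  ext x
  have hb : b = a * (a⁻¹ * b) := by group
  rw [hb, map_mul, MulAut.mul_apply, MulAut.conj_apply (a⁻¹ * b) x, ← hz x,
    mul_inv_cancel_right]

/-- If `A / K` is abelian and `K` is central, inner automorphisms by elements of `A` commute. -/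
theorem conj_commute_of_commutator_mem {G : Type*} [Group G] {K A : Subgroup G}
    (hKZ : K ≤ Subgroup.center G)
    (hAK : ∀ a ∈ A, ∀ b ∈ A, a * b * a⁻¹ * b⁻¹ ∈ K) {a b : G} (ha : a ∈ A) (hb : b ∈ A) :
    Commute (MulAut.conj a) (MulAut.conj b) := by
  rw [commute_iff_eq, ← map_mul, ← map_mul]
  refine (conj_eq_of_mk_eq hKZ (QuotientGroup.eq.mpr ?_)).symm
  have h := hAK _ (A.inv_mem ha) _ (A.inv_mem hb)
  simpa [mul_assoc] using h

/-- A lifting of an endomorphism of `G / K` acts on `G` by inner automorphisms through a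
homomorphism when `K` is central. -/
theorem conj_lift_mul {G : Type*} [Group G] {K : Subgroup G} [K.Normal]
    (hKZ : K ≤ Subgroup.center G) {φ : G ⧸ K →* G ⧸ K} {f : G → G}
    (hf : ∀ g : G, (QuotientGroup.mk (f g) : G ⧸ K) = φ (QuotientGroup.mk g)) (x y : G) :
    MulAut.conj (f (x * y)) = MulAut.conj (f x) * MulAut.conj (f y) := by
  rw [← map_mul]
  apply conj_eq_of_mk_eq hKZ
  rw [QuotientGroup.mk_mul, hf, hf, hf, QuotientGroup.mk_mul, map_mul]

/-- Lifts of the trivial class act trivially. -/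
theorem conj_lift_eq_one {G : Type*} [Group G] {K : Subgroup G} [K.Normal]
    (hKZ : K ≤ Subgroup.center G) {φ : G ⧸ K →* G ⧸ K} {f : G → G}
    (hf : ∀ g : G, (QuotientGroup.mk (f g) : G ⧸ K) = φ (QuotientGroup.mk g)) {z : G}
    (hz : z ∈ K) : MulAut.conj (f z) = 1 := by
  rw [← map_one MulAut.conj]
  apply conj_eq_of_mk_eq hKZ
  rw [hf, (QuotientGroup.eq_one_iff z).mpr hz, map_one, QuotientGroup.mk_one]

/-- Main theorem: `(G, ∘_{φ,β}, ∘_{ψ,α})` is a skew brace. -/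
theorem stmt_3
    {G : Type*} [Group G] (K A : Subgroup G) [K.Normal]
    (hKZ : K ≤ Subgroup.center G) (hKA : K ≤ A)
    (hAK : ∀ a ∈ A, ∀ b ∈ A, a * b * a⁻¹ * b⁻¹ ∈ K)
    (ψ : G ⧸ K →* G ⧸ K)
    (hψA : ∀ x : G ⧸ K, ψ x ∈ Subgroup.map (QuotientGroup.mk' K) A)
    (l : G → G) (hlA : ∀ g, l g ∈ A)
    (hl : ∀ g : G, (QuotientGroup.mk (l g) : G ⧸ K) = ψ (QuotientGroup.mk g))
    (φ : G ⧸ K →* G ⧸ K)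
    (hφA : ∀ x : G ⧸ K, φ x ∈ Subgroup.map (QuotientGroup.mk' K) A)
    (f : G → G) (hfA : ∀ g, f g ∈ A)
    (hf : ∀ g : G, (QuotientGroup.mk (f g) : G ⧸ K) = φ (QuotientGroup.mk g))
    (α : G → G → G) (hαK : ∀ g h, α g h ∈ K)
    (hαmul₁ : ∀ g h k : G, α (g * h) k = α g k * α h k)
    (hαmul₂ : ∀ g h k : G, α g (h * k) = α g h * α g k)
    (hαK₁ : ∀ g : G, ∀ k ∈ K, α k g = 1)
    (hαK₂ : ∀ g : G, ∀ k ∈ K, α g k = 1)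
    (β : G → G → G) (hβK : ∀ g h, β g h ∈ K)
    (hβmul₁ : ∀ g h k : G, β (g * h) k = β g k * β h k)
    (hβmul₂ : ∀ g h k : G, β g (h * k) = β g h * β g k)
    (hβK₁ : ∀ g : G, ∀ k ∈ K, β k g = 1)
    (hβK₂ : ∀ g : G, ∀ k ∈ K, β g k = 1)
    (circψ : G → G → G)
    (hcircψ : ∀ g h : G, circψ g h = g * l g * h * (l g)⁻¹ * α g h)
    (circφ : G → G → G)
    (hcircφ : ∀ g h : G, circφ g h = g * f g * h * (f g)⁻¹ * β g h)
    :
    ∀ g h k : G,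
      circψ g (circφ h k) =
        circφ (circφ (circψ g h) ((f g)⁻¹ * g⁻¹ * f g * β g g)) (circψ g k) := by
  intro g h k
  have hz : ∀ {z : G}, z ∈ K → ∀ x, x * z = z * x := fun hzK =>
    Subgroup.mem_center_iff.mp (hKZ hzK)
  have conj_fix : ∀ (a : G) {z : G}, z ∈ K → MulAut.conj a z = z := fun a z hzK => by
    rw [MulAut.conj_apply, hz hzK, mul_inv_cancel_right]
  -- Conjugation by `f x`, as a homomorphism in `x`.
  let F : G →* MulAut G := MonoidHom.mk' (fun x => MulAut.conj (f x)) (conj_lift_mul hKZ hf)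
  have F_apply : ∀ x, F x = MulAut.conj (f x) := fun _ => rfl
  have F_K : ∀ z ∈ K, F z = 1 := fun z hzK => conj_lift_eq_one hKZ hf hzK
  have F_comm : ∀ x y, F x * F y = F y * F x := fun x y =>
    conj_commute_of_commutator_mem hKZ hAK (hfA x) (hfA y)
  have F_conj : ∀ a x, F (MulAut.conj a x) = F x := fun a x => by
    rw [MulAut.conj_apply, map_mul, map_mul, F_comm a x, map_inv, mul_inv_cancel_right]
  have hα_conj : ∀ u a x, α u (MulAut.conj a x) = α u x := fun u a x => by
    have h1 : α u a * α u a⁻¹ = 1 := by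
      rw [← hαmul₂, mul_inv_cancel]; exact hαK₂ u 1 K.one_mem
    rw [MulAut.conj_apply, hαmul₂, hαmul₂, ← hz (hαK u a), mul_assoc, h1, mul_one]
  have hβ_inv₁ : ∀ a u, β a u * β a⁻¹ u = 1 := fun a u => by
    rw [← hβmul₁, mul_inv_cancel]; exact hβK₁ u 1 K.one_mem
  have hβ_inv₂ : ∀ u a, β u a * β u a⁻¹ = 1 := fun u a => by
    rw [← hβmul₂, mul_inv_cancel]; exact hβK₂ u 1 K.one_mem
  have hβ_conj₁ : ∀ a x u, β (MulAut.conj a x) u = β x u := fun a x u => by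
    rw [MulAut.conj_apply, hβmul₁, hβmul₁, ← hz (hβK a u), mul_assoc, hβ_inv₁, mul_one]
  have hβ_conj₂ : ∀ u a x, β u (MulAut.conj a x) = β u x := fun u a x => by
    rw [MulAut.conj_apply, hβmul₂, hβmul₂, ← hz (hβK u a), mul_assoc, hβ_inv₂, mul_one]
  have circψ_eq : ∀ x y, circψ x y = x * MulAut.conj (l x) y * α x y := fun x y => by
    rw [hcircψ, MulAut.conj_apply]; group
  have circφ_eq : ∀ x y, circφ x y = x * F x y * β x y := fun x y => by
    rw [hcircφ, F_apply, MulAut.conj_apply]; group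
  have F_fix : ∀ x {z : G}, z ∈ K → F x z = z := fun x _ hzK => conj_fix (f x) hzK
  have hinv : (f g)⁻¹ * g⁻¹ * f g * β g g = (F g)⁻¹ g⁻¹ * β g g := by
    rw [F_apply, MulAut.conj_inv_apply]
  have hβ_Finv : ∀ u x, β u ((F g)⁻¹ x) = β u x := fun u x => by
    rw [F_apply, ← map_inv]; exact hβ_conj₂ _ _ _
  have hquot : circφ (circψ g h) ((F g)⁻¹ g⁻¹ * β g g) =
      g * MulAut.conj (l g) h * F h g⁻¹ * α g h * β h g⁻¹ := by
    have hFu : F (circψ g h) = F h * F g := by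
      rw [circψ_eq, map_mul, map_mul, F_conj, F_K _ (hαK g h), mul_one, F_comm]
    have hβu : β (circψ g h) ((F g)⁻¹ g⁻¹ * β g g) = β g g⁻¹ * β h g⁻¹ := by
      rw [hβmul₂, hβ_Finv, hβK₂ _ _ (hβK g g), mul_one, circψ_eq, hβmul₁, hβmul₁, hβ_conj₁,
        hβK₁ _ _ (hαK g h), mul_one]
    rw [circφ_eq, hFu, hβu, map_mul (F h * F g), MulAut.mul_apply, MulAut.mul_apply,
      F_fix g (hβK g g), F_fix h (hβK g g), MulAut.apply_inv_self, circψ_eq]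
    simp only [mul_assoc]
    rw [← mul_assoc (β g g), hβ_inv₂, one_mul, ← mul_assoc (α g h), ← hz (hαK g h), mul_assoc]
  have hFX : F (g * MulAut.conj (l g) h * F h g⁻¹ * α g h * β h g⁻¹) = F h := by
    simp only [map_mul, F_K _ (hαK g h), F_K _ (hβK h g⁻¹), mul_one]
    have hFF : F (F h g⁻¹) = F g⁻¹ := F_conj (f h) g⁻¹
    rw [F_conj, hFF, F_comm g, mul_assoc, ← map_mul, mul_inv_cancel, map_one, mul_one]
  have hβX : ∀ u, β (g * MulAut.conj (l g) h * F h g⁻¹ * α g h * β h g⁻¹) u = β h u := fun u => by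
    rw [hβmul₁, hβmul₁, hβmul₁, hβmul₁, hβK₁ _ _ (hαK g h), hβK₁ _ _ (hβK h g⁻¹), mul_one,
      mul_one, F_apply, hβ_conj₁, hβ_conj₁, ← hz (hβK g u), mul_assoc, hβ_inv₁, mul_one]
  have hFl : F h (MulAut.conj (l g) k) = MulAut.conj (l g) (F h k) :=
    DFunLike.congr_fun (conj_commute_of_commutator_mem hKZ hAK (hfA h) (hlA g)).eq k
  rw [hinv, hquot, circφ_eq _ (circψ g k), hFX, hβX, circψ_eq g k, circψ_eq, circφ_eq,
    map_mul (F h), map_mul (F h), F_fix h (hαK g k), hFl, hβmul₂, hβmul₂, hβ_conj₂,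
    hβK₂ _ _ (hαK g k), mul_one, map_mul, map_mul, conj_fix _ (hβK h k), hαmul₂, hαmul₂,
    hαK₂ _ _ (hβK h k), mul_one, F_apply, hα_conj, map_inv]
  generalize MulAut.conj (l g) h = p, MulAut.conj (f h) g = q,
    MulAut.conj (l g) (MulAut.conj (f h) k) = r
  calc g * (p * r * β h k) * (α g h * α g k)
      = g * p * r * (β h k * (α g h * α g k)) := by group
    _ = g * p * r * (α g h * α g k * β h k) := by rw [hz (hβK h k)]
    _ = g * p * q⁻¹ * (q * r * α g h) * α g k * (β h g * β h g⁻¹) * β h k := by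
      rw [hβ_inv₂]; group
    _ = g * p * q⁻¹ * α g h * (q * r * α g k * β h g * β h g⁻¹) * β h k := by
      rw [hz (hαK g h) (q * r)]; simp only [mul_assoc]
    _ = g * p * q⁻¹ * α g h * β h g⁻¹ * (q * r * α g k) * (β h g * β h k) := by
      rw [hz (hβK h g⁻¹) (q * r * α g k * β h g)]; simp only [mul_assoc]
end

section
/- The triple (G, ·, ∘) is a bi-skew brace: for all g, h, k ∈ G one has (i) g ∘ (h · k) = (g ∘ h) · g⁻¹ · (g ∘ k), and (ii) g · (h ∘ k) = ((g · h) ∘ ḡ) ∘ (g · k), where ḡ = ψ↑(g)⁻¹ · g⁻¹ · ψ↑(g) · α(g,g) is the inverse of g with respect to ∘. -/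
/-- Elements congruent modulo a central subgroup act identically by conjugation. -/
theorem conj_eq_conj_of_mk_eq {G : Type*} [Group G] {K : Subgroup G}
    (hKZ : K ≤ Subgroup.center G) {a b : G}
    (hab : (QuotientGroup.mk a : G ⧸ K) = QuotientGroup.mk b) (y : G) :
    a * y * a⁻¹ = b * y * b⁻¹ := by
  have hy := Subgroup.mem_center_iff.1 (hKZ (QuotientGroup.eq.1 hab)) y
  calc a * y * a⁻¹ = a * (y * (a⁻¹ * b)) * b⁻¹ := by group
    _ = b * y * b⁻¹ := by rw [hy]; group

/-- `(G, ·, ∘)` is a bi-skew brace. -/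
theorem stmt_4
    {G : Type*} [Group G] (K A : Subgroup G) [K.Normal]
    (hKZ : K ≤ Subgroup.center G) (hKA : K ≤ A)
    (hAK : ∀ a ∈ A, ∀ b ∈ A, a * b * a⁻¹ * b⁻¹ ∈ K)
    (ψ : G ⧸ K →* G ⧸ K)
    (hψA : ∀ x : G ⧸ K, ψ x ∈ Subgroup.map (QuotientGroup.mk' K) A)
    (l : G → G) (hlA : ∀ g, l g ∈ A)
    (hl : ∀ g : G, (QuotientGroup.mk (l g) : G ⧸ K) = ψ (QuotientGroup.mk g))
    (α : G → G → G) (hαK : ∀ g h, α g h ∈ K)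
    (hαmul₁ : ∀ g h k : G, α (g * h) k = α g k * α h k)
    (hαmul₂ : ∀ g h k : G, α g (h * k) = α g h * α g k)
    (hαK₁ : ∀ g : G, ∀ k ∈ K, α k g = 1)
    (hαK₂ : ∀ g : G, ∀ k ∈ K, α g k = 1)
    (circ : G → G → G)
    (hcirc : ∀ g h : G, circ g h = g * l g * h * (l g)⁻¹ * α g h)
    :
    ∀ g h k : G,
      circ g (h * k) = circ g h * g⁻¹ * circ g k ∧
      g * circ h k = circ (circ (g * h) ((l g)⁻¹ * g⁻¹ * l g * α g g)) (g * k) := by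
  have central : ∀ g h x, x * α g h = α g h * x := fun g h x =>
    Subgroup.mem_center_iff.1 (hKZ (hαK g h)) x
  have α_inv₁ : ∀ g k, α g⁻¹ k = (α g k)⁻¹ := fun g k =>
    map_inv (MonoidHom.mk' (fun g => α g k) fun a b => hαmul₁ a b k) g
  have α_inv₂ : ∀ g k, α g k⁻¹ = (α g k)⁻¹ := fun g k =>
    map_inv (MonoidHom.mk' (α g) (hαmul₂ g)) k
  have α_conj₁ : ∀ a b y, α (a * b * a⁻¹) y = α b y := fun a b y => by
    rw [hαmul₁, hαmul₁, α_inv₁, central b y, mul_inv_cancel_right]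
  have α_conj₂ : ∀ y a b, α y (a⁻¹ * b * a) = α y b := fun y a b => by
    rw [hαmul₂, hαmul₂, α_inv₂, mul_assoc, central y a (α y b), inv_mul_cancel_left]
  have ψ_comm : ∀ x y : G, ψ x * ψ y = ψ y * ψ x := by
    intro x y
    rw [← hl, ← hl, ← QuotientGroup.mk_mul, ← QuotientGroup.mk_mul, eq_comm, QuotientGroup.eq]
    have := hAK _ (A.inv_mem (hlA x)) _ (A.inv_mem (hlA y))
    simpa [mul_assoc] using this
  have ψ_eq_one : ∀ z ∈ K, ψ (z : G) = 1 := fun z hz => by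
    rw [(QuotientGroup.eq_one_iff z).2 hz, map_one]
  intro g h k
  constructor
  · rw [hcirc, hcirc, hcirc, hαmul₂]
    calc g * l g * (h * k) * (l g)⁻¹ * (α g h * α g k)
        = g * l g * h * (l g)⁻¹ * ((l g * k * (l g)⁻¹) * α g h) * α g k := by group
      _ = _ := by rw [central g h (l g * k * (l g)⁻¹)]; group
  · have hx : circ (g * h) ((l g)⁻¹ * g⁻¹ * l g * α g g)
        = g * h * (l h * g⁻¹ * (l h)⁻¹) * (α h g)⁻¹ := by
      have hα : α (g * h) ((l g)⁻¹ * g⁻¹ * l g * α g g) = (α h g)⁻¹ * (α g g)⁻¹ := by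
        rw [hαmul₂, hαK₂ _ _ (hαK g g), α_conj₂, α_inv₂, hαmul₁, mul_one, mul_inv_rev]
      have hconj : (QuotientGroup.mk (l (g * h) * (l g)⁻¹) : G ⧸ K) = QuotientGroup.mk (l h) := by
        rw [QuotientGroup.mk_mul, QuotientGroup.mk_inv, hl, hl, hl, QuotientGroup.mk_mul, map_mul,
          ψ_comm, mul_inv_cancel_right]
      rw [hcirc, hα, ← conj_eq_conj_of_mk_eq hKZ hconj]
      calc _ = g * h * (l (g * h) * ((l g)⁻¹ * g⁻¹ * l g)) * (α g g * (l (g * h))⁻¹)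
              * (α h g)⁻¹ * (α g g)⁻¹ := by group
        _ = g * h * (l (g * h) * ((l g)⁻¹ * g⁻¹ * l g)) * (l (g * h))⁻¹
              * (α g g * (α h g)⁻¹) * (α g g)⁻¹ := by rw [← central]; group
        _ = _ := by rw [← central]; group
    rw [hx]
    set x := g * h * (l h * g⁻¹ * (l h)⁻¹) * (α h g)⁻¹ with hxdef
    have hψx : (QuotientGroup.mk (l x) : G ⧸ K) = QuotientGroup.mk (l h) := by
      rw [hl, hl, hxdef]
      simp only [QuotientGroup.mk_mul, QuotientGroup.mk_inv, map_mul, map_inv,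
        ψ_eq_one _ (hαK h g)]
      rw [ψ_comm g h, ← map_inv ψ (g : G ⧸ K), ← QuotientGroup.mk_inv, ψ_comm (l h) g⁻¹,
        QuotientGroup.mk_inv, map_inv]
      group
    have hαx : ∀ y, α x y = α h y := by
      intro y
      rw [hxdef, hαmul₁, α_inv₁, hαK₁ _ _ (hαK h g), hαmul₁, hαmul₁, α_conj₁, α_inv₁,
        central h y, inv_one, mul_one, mul_inv_cancel_right]
    have hconj : l x * (g * k) * (l x)⁻¹ = l h * (g * k) * (l h)⁻¹ :=
      conj_eq_conj_of_mk_eq hKZ hψx _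
    symm
    calc circ x (g * k) = x * (l x * (g * k) * (l x)⁻¹) * (α h g * α h k) := by
          rw [hcirc, hαx, hαmul₂]; group
      _ = x * ((l h * (g * k) * (l h)⁻¹) * α h g) * α h k := by rw [hconj]; group
      _ = g * circ h k := by rw [central h g, hcirc, hxdef]; group
end

section
/- Every map β : G × G → K that is bilinear with respect to · and vanishes on K is also bilinear with respect to ∘: for all g, h, k ∈ G, β(g ∘ h, k) = β(g,k) · β(h,k) and β(g, h ∘ k) = β(g,h) · β(g,k). -/
/-- A homomorphism with central values does not see conjugation, nor factors in its kernel. -/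
theorem MonoidHom.map_mul_conj_mul_of_central {G H : Type*} [Group G] [Group H] (f : G →* H)
    (hf : ∀ x, f x ∈ Subgroup.center H) (g a h : G) {c : G} (hc : f c = 1) :
    f (g * a * h * a⁻¹ * c) = f g * f h := by
  have hcomm : f a * f h = f h * f a := (Subgroup.mem_center_iff.mp (hf h) (f a))
  simp only [map_mul, map_inv, hc, mul_one]
  rw [mul_assoc (f g), hcomm, ← mul_assoc, mul_inv_cancel_right]

/-- Every `·`-bilinear map `β : G × G → K` vanishing on `K` is also bilinear with
respect to `∘`. -/
theorem stmt_7
    {G : Type*} [Group G] (K A : Subgroup G) [K.Normal]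
    (hKZ : K ≤ Subgroup.center G) (hKA : K ≤ A)
    (hAK : ∀ a ∈ A, ∀ b ∈ A, a * b * a⁻¹ * b⁻¹ ∈ K)
    (ψ : G ⧸ K →* G ⧸ K)
    (hψA : ∀ x : G ⧸ K, ψ x ∈ Subgroup.map (QuotientGroup.mk' K) A)
    (l : G → G) (hlA : ∀ g, l g ∈ A)
    (hl : ∀ g : G, (QuotientGroup.mk (l g) : G ⧸ K) = ψ (QuotientGroup.mk g))
    (α : G → G → G) (hαK : ∀ g h, α g h ∈ K)
    (hαmul₁ : ∀ g h k : G, α (g * h) k = α g k * α h k)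
    (hαmul₂ : ∀ g h k : G, α g (h * k) = α g h * α g k)
    (hαK₁ : ∀ g : G, ∀ k ∈ K, α k g = 1)
    (hαK₂ : ∀ g : G, ∀ k ∈ K, α g k = 1)
    (circ : G → G → G)
    (hcirc : ∀ g h : G, circ g h = g * l g * h * (l g)⁻¹ * α g h)
    (β : G → G → G) (hβK : ∀ g h, β g h ∈ K)
    (hβmul₁ : ∀ g h k : G, β (g * h) k = β g k * β h k)
    (hβmul₂ : ∀ g h k : G, β g (h * k) = β g h * β g k)
    (hβK₁ : ∀ g : G, ∀ k ∈ K, β k g = 1)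
    (hβK₂ : ∀ g : G, ∀ k ∈ K, β g k = 1)
    :
    ∀ g h k : G,
      β (circ g h) k = β g k * β h k ∧
      β g (circ h k) = β g h * β g k := by
  intro g h k
  rw [hcirc, hcirc]
  exact ⟨(MonoidHom.mk' (β · k) fun x y => hβmul₁ x y k).map_mul_conj_mul_of_central
      (fun x => hKZ (hβK x k)) g (l g) h (hβK₁ k _ (hαK g h)),
    (MonoidHom.mk' (β g) (hβmul₂ g)).map_mul_conj_mul_of_central
      (fun x => hKZ (hβK g x)) h (l h) k (hβK₂ g _ (hαK h k))⟩
end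

section
/- (Conjugation formula) For all x, y ∈ G, writing x̄ = ψ↑(x)⁻¹ · x⁻¹ · ψ↑(x) · α(x,x) for the inverse of x with respect to ∘, one has (x ∘ y) ∘ x̄ = x · ψ↑(x) · y · ψ↑(x)⁻¹ · ψ↑(y) · x⁻¹ · ψ↑(y)⁻¹ · α(x,y) · α(y,x⁻¹). -/
/-- Conjugation formula with respect to `∘`. -/
theorem stmt_8
    {G : Type*} [Group G] (K A : Subgroup G) [K.Normal]
    (hKZ : K ≤ Subgroup.center G) (hKA : K ≤ A)
    (hAK : ∀ a ∈ A, ∀ b ∈ A, a * b * a⁻¹ * b⁻¹ ∈ K)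
    (ψ : G ⧸ K →* G ⧸ K)
    (hψA : ∀ x : G ⧸ K, ψ x ∈ Subgroup.map (QuotientGroup.mk' K) A)
    (l : G → G) (hlA : ∀ g, l g ∈ A)
    (hl : ∀ g : G, (QuotientGroup.mk (l g) : G ⧸ K) = ψ (QuotientGroup.mk g))
    (α : G → G → G) (hαK : ∀ g h, α g h ∈ K)
    (hαmul₁ : ∀ g h k : G, α (g * h) k = α g k * α h k)
    (hαmul₂ : ∀ g h k : G, α g (h * k) = α g h * α g k)
    (hαK₁ : ∀ g : G, ∀ k ∈ K, α k g = 1)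
    (hαK₂ : ∀ g : G, ∀ k ∈ K, α g k = 1)
    (circ : G → G → G)
    (hcirc : ∀ g h : G, circ g h = g * l g * h * (l g)⁻¹ * α g h)
    :
    ∀ x y : G,
      circ (circ x y) ((l x)⁻¹ * x⁻¹ * l x * α x x) =
        x * l x * y * (l x)⁻¹ * l y * x⁻¹ * (l y)⁻¹ * α x y * α y (x⁻¹) := by
  intro x y
  have central : ∀ k ∈ K, ∀ g : G, g * k = k * g := fun k hk g =>
    Subgroup.mem_center_iff.mp (hKZ hk) g
  have α_comm : ∀ a b g : G, g * α a b = α a b * g := fun a b g =>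
    central _ (hαK a b) g
  have α_one₁ : ∀ g, α 1 g = 1 := fun g => hαK₁ g 1 K.one_mem
  have α_one₂ : ∀ g, α g 1 = 1 := fun g => hαK₂ g 1 K.one_mem
  have α_conj₁ : ∀ a g h : G, α (a * g * a⁻¹) h = α g h := by
    intro a g h
    rw [hαmul₁, hαmul₁, α_comm g h (α a h), mul_assoc, ← hαmul₁, mul_inv_cancel, α_one₁, mul_one]
  have α_conj₂ : ∀ a g h : G, α h (a⁻¹ * g * a) = α h g := by
    intro a g h
    rw [hαmul₂, hαmul₂, α_comm h g (α h a⁻¹), mul_assoc, ← hαmul₂, inv_mul_cancel, α_one₂, mul_one]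
  have ψ_comm : ∀ g h : G, ψ (g : G ⧸ K) * ψ (h : G ⧸ K) = ψ (h : G ⧸ K) * ψ (g : G ⧸ K) := by
    intro g h
    rw [← hl, ← hl, ← QuotientGroup.mk_mul, ← QuotientGroup.mk_mul, QuotientGroup.eq]
    have := hAK (l h)⁻¹ (A.inv_mem (hlA h)) (l g)⁻¹ (A.inv_mem (hlA g))
    simpa [mul_assoc] using this
  set w := circ x y with hw
  have w_eq : w = x * (l x * y * (l x)⁻¹) * α x y := by
    rw [hw, hcirc]; group
  obtain ⟨k, hk, l_w⟩ : ∃ k ∈ K, l w = l y * l x * k := by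
    refine ⟨(l y * l x)⁻¹ * l w, ?_, by group⟩
    rw [← QuotientGroup.eq, QuotientGroup.mk_mul, hl, hl, hl, w_eq]
    have hα : ((α x y : G) : G ⧸ K) = 1 := (QuotientGroup.eq_one_iff _).mpr (hαK x y)
    simp only [QuotientGroup.mk_mul, QuotientGroup.mk_inv, map_mul, map_inv, hα, mul_one]
    rw [ψ_comm (l x) y, mul_inv_cancel_right, ψ_comm]
  have α_w : α w ((l x)⁻¹ * x⁻¹ * l x * α x x) = α x x⁻¹ * α y x⁻¹ := by
    rw [hαmul₂, hαK₂ _ _ (hαK x x), mul_one, α_conj₂, w_eq, hαmul₁, hαK₁ _ _ (hαK x y), mul_one,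
      hαmul₁, α_conj₁]
  have α_cancel : α x x * α x x⁻¹ = 1 := by rw [← hαmul₂, mul_inv_cancel, α_one₂]
  have conj_w : l w * ((l x)⁻¹ * x⁻¹ * l x * α x x) * (l w)⁻¹ =
      l y * x⁻¹ * (l y)⁻¹ * α x x := by
    have hconj : ∀ g, l w * g * (l w)⁻¹ = l y * l x * g * (l y * l x)⁻¹ := by
      intro g
      rw [l_w, mul_assoc _ k g, ← central k hk g]
      group
    rw [hconj, ← mul_assoc, mul_assoc _ (α x x), ← α_comm x x (l y * l x)⁻¹]
    group
  calc circ w ((l x)⁻¹ * x⁻¹ * l x * α x x)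
      = w * (l w * ((l x)⁻¹ * x⁻¹ * l x * α x x) * (l w)⁻¹) * (α x x⁻¹ * α y x⁻¹) := by
        rw [hcirc, α_w]; group
    _ = w * (l y * x⁻¹ * (l y)⁻¹) * (α x x * α x x⁻¹) * α y x⁻¹ := by
        rw [conj_w]; group
    _ = x * (l x * y * (l x)⁻¹) * (l y * x⁻¹ * (l y)⁻¹ * α x y) * α y x⁻¹ := by
        rw [α_cancel, mul_one, w_eq, mul_assoc _ (α x y), ← α_comm x y]
    _ = _ := by group
end

section
/- Let G be a group, A an abelian subgroup of G, and ψ, φ group endomorphisms of G whose images are contained in A. Define g ∘_ψ h = g · ψ(g) · h · ψ(g)⁻¹ and g ∘_φ h = g · φ(g) · h · φ(g)⁻¹. Then each of (G, ∘_ψ) and (G, ∘_φ) is a group with identity 1, and (G, ∘_φ, ∘_ψ) is a skew brace: for all g, h, k ∈ G, g ∘_ψ (h ∘_φ k) = ((g ∘_ψ h) ∘_φ ḡ) ∘_φ (g ∘_ψ k), where ḡ = φ(g)⁻¹ · g⁻¹ · φ(g) is the inverse of g with respect to ∘_φ. -/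
/-- A homomorphism with commutative range does not see conjugations. -/
theorem map_mul_conj_of_commute {G : Type*} [Group G] (f : G →* G)
    (hf : ∀ x y : G, Commute (f x) (f y)) (a b c : G) :
    f (a * b * c * b⁻¹) = f a * f c := by
  simp only [map_mul, map_inv]
  rw [mul_assoc (f a), (hf b c).eq]
  group

theorem map_inv_conj_of_commute {G : Type*} [Group G] (f : G →* G)
    (hf : ∀ x y : G, Commute (f x) (f y)) (a b : G) :
    f (b⁻¹ * a⁻¹ * b) = (f a)⁻¹ := by
  simp only [map_mul, map_inv]
  rw [← mul_inv_rev, (hf a b).eq]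
  group

theorem conj_circ_assoc {G : Type*} [Group G] (f : G →* G)
    (hf : ∀ x y : G, Commute (f x) (f y)) (circ : G → G → G)
    (hcirc : ∀ g h : G, circ g h = g * f g * h * (f g)⁻¹) (g h k : G) :
    circ (circ g h) k = circ g (circ h k) := by
  rw [hcirc (circ g h), hcirc g h, map_mul_conj_of_commute f hf, hcirc, hcirc]
  group

theorem conj_circ_one {G : Type*} [Group G] (f : G →* G) (circ : G → G → G)
    (hcirc : ∀ g h : G, circ g h = g * f g * h * (f g)⁻¹) (g : G) :
    circ 1 g = g ∧ circ g 1 = g := by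
  simp [hcirc]

theorem conj_circ_inv {G : Type*} [Group G] (f : G →* G)
    (hf : ∀ x y : G, Commute (f x) (f y)) (circ : G → G → G)
    (hcirc : ∀ g h : G, circ g h = g * f g * h * (f g)⁻¹) (g : G) :
    circ g ((f g)⁻¹ * g⁻¹ * f g) = 1 ∧ circ ((f g)⁻¹ * g⁻¹ * f g) g = 1 := by
  rw [hcirc, hcirc, map_inv_conj_of_commute f hf]
  constructor <;> group

/-- For endomorphisms `ψ, φ` of `G` with image in an abelian subgroup `A`, the operations
`∘_ψ` and `∘_φ` are group operations with identity `1`, and `(G, ∘_φ, ∘_ψ)` is a skew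
brace. -/
theorem stmt_12 {G : Type*} [Group G] (A : Subgroup G)
    (hA : ∀ a ∈ A, ∀ b ∈ A, a * b = b * a)
    (ψ φ : G →* G)
    (hψ : ∀ g : G, ψ g ∈ A) (hφ : ∀ g : G, φ g ∈ A)
    (circψ circφ : G → G → G)
    (hcircψ : ∀ g h : G, circψ g h = g * ψ g * h * (ψ g)⁻¹)
    (hcircφ : ∀ g h : G, circφ g h = g * φ g * h * (φ g)⁻¹) :
    (∀ g h k : G, circψ (circψ g h) k = circψ g (circψ h k)) ∧
    (∀ g : G, circψ 1 g = g ∧ circψ g 1 = g) ∧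
    (∀ g : G, ∃ g' : G, circψ g g' = 1 ∧ circψ g' g = 1) ∧
    (∀ g h k : G, circφ (circφ g h) k = circφ g (circφ h k)) ∧
    (∀ g : G, circφ 1 g = g ∧ circφ g 1 = g) ∧
    (∀ g : G,
      circφ g ((φ g)⁻¹ * g⁻¹ * φ g) = 1 ∧ circφ ((φ g)⁻¹ * g⁻¹ * φ g) g = 1) ∧
    (∀ g h k : G,
      circψ g (circφ h k) =
        circφ (circφ (circψ g h) ((φ g)⁻¹ * g⁻¹ * φ g)) (circψ g k)) := by
  have hψc : ∀ x y : G, Commute (ψ x) (ψ y) := fun x y => hA _ (hψ x) _ (hψ y)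
  have hφc : ∀ x y : G, Commute (φ x) (φ y) := fun x y => hA _ (hφ x) _ (hφ y)
  refine ⟨conj_circ_assoc ψ hψc circψ hcircψ, conj_circ_one ψ circψ hcircψ,
    fun g => ⟨_, conj_circ_inv ψ hψc circψ hcircψ g⟩,
    conj_circ_assoc φ hφc circφ hcircφ, conj_circ_one φ circφ hcircφ,
    conj_circ_inv φ hφc circφ hcircφ, fun g h k => ?_⟩
  have hmap : φ (circψ g h) = φ h * φ g := by
    rw [hcircψ, map_mul_conj_of_commute φ hφc, (hφc g h).eq]
  have hmap' : φ (circφ (circψ g h) ((φ g)⁻¹ * g⁻¹ * φ g)) = φ h := by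
    rw [hcircφ, map_mul_conj_of_commute φ hφc, hmap, map_inv_conj_of_commute φ hφc,
      mul_inv_cancel_right]
  have hquot : circφ (circψ g h) ((φ g)⁻¹ * g⁻¹ * φ g) =
      g * ψ g * h * (ψ g)⁻¹ * φ h * g⁻¹ * (φ h)⁻¹ := by
    rw [hcircφ, hmap, hcircψ]
    group
  have hcomm : φ h * ψ g = ψ g * φ h := hA _ (hφ h) _ (hψ g)
  rw [hcircφ (circφ _ _), hmap', hquot, hcircψ, hcircψ, hcircφ]
  calc g * ψ g * (h * φ h * k * (φ h)⁻¹) * (ψ g)⁻¹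
      = g * ψ g * h * (ψ g)⁻¹ * (ψ g * φ h) * k * (ψ g * φ h)⁻¹ := by group
    _ = g * ψ g * h * (ψ g)⁻¹ * (φ h * ψ g) * k * (φ h * ψ g)⁻¹ := by rw [hcomm]
    _ = _ := by group
end

section
/- Let G be a group of nilpotence class at most two, i.e. with commutator subgroup [G,G] contained in the center Z(G). For n ∈ ℤ define g ∘ₙ h = g · h · [g,h]ⁿ, where [g,h] = g·h·g⁻¹·h⁻¹. Then each (G, ∘ₙ) is a group with identity 1 in which the inverse of g is g⁻¹, and for all m, n ∈ ℤ the triple (G, ∘ₘ, ∘ₙ) is a skew brace: g ∘ₙ (h ∘ₘ k) = ((g ∘ₙ h) ∘ₘ g⁻¹) ∘ₘ (g ∘ₙ k) for all g, h, k ∈ G. -/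
open scoped IsMulCommutative

/-- The commutator of a group of nilpotence class at most two, as a central element. -/
def centralCommutator {G : Type*} [Group G] (hG : commutator G ≤ Subgroup.center G) (g h : G) :
    Subgroup.center G :=
  ⟨g * h * g⁻¹ * h⁻¹,
    hG (Subgroup.commutator_mem_commutator (Subgroup.mem_top g) (Subgroup.mem_top h))⟩

section

variable {G : Type*} [Group G]

theorem mul_center_mul (z : Subgroup.center G) (a b : G) : a * z * b = a * b * z := by
  rw [mul_assoc, mul_assoc, Subgroup.mem_center_iff.mp z.2 b]

variable (hG : commutator G ≤ Subgroup.center G)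

theorem centralCommutator_mul_left (a b k : G) :
    centralCommutator hG (a * b) k = centralCommutator hG a k * centralCommutator hG b k := by
  have key : a * b * k * (a * b)⁻¹ * k⁻¹ =
      a * (centralCommutator hG b k : G) * (k * a⁻¹ * k⁻¹) := by
    simp only [centralCommutator]
    group
  ext
  change a * b * k * (a * b)⁻¹ * k⁻¹ = a * k * a⁻¹ * k⁻¹ * (centralCommutator hG b k : G)
  rw [key, mul_center_mul]
  simp only [mul_assoc]

theorem centralCommutator_inv (a b : G) :
    (centralCommutator hG a b)⁻¹ = centralCommutator hG b a := by
  ext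
  simp [centralCommutator, mul_assoc]

theorem centralCommutator_mul_right (a b k : G) :
    centralCommutator hG k (a * b) = centralCommutator hG k a * centralCommutator hG k b := by
  rw [← centralCommutator_inv, centralCommutator_mul_left, mul_inv, centralCommutator_inv,
    centralCommutator_inv]

theorem centralCommutator_self (a : G) : centralCommutator hG a a = 1 := by
  ext
  simp [centralCommutator]

theorem centralCommutator_center_left (z : Subgroup.center G) (a : G) :
    centralCommutator hG z a = 1 := by
  ext
  simp [centralCommutator, ← Subgroup.mem_center_iff.mp z.2 a]

theorem centralCommutator_center_right (z : Subgroup.center G) (a : G) :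
    centralCommutator hG a z = 1 := by
  rw [← centralCommutator_inv, centralCommutator_center_left, inv_one]

theorem centralCommutator_one_left (a : G) : centralCommutator hG 1 a = 1 :=
  centralCommutator_center_left hG 1 a

theorem centralCommutator_inv_left (a b : G) :
    centralCommutator hG a⁻¹ b = (centralCommutator hG a b)⁻¹ := by
  rw [eq_inv_iff_mul_eq_one, ← centralCommutator_mul_left, inv_mul_cancel,
    centralCommutator_one_left]

theorem centralCommutator_inv_right (a b : G) :
    centralCommutator hG a b⁻¹ = (centralCommutator hG a b)⁻¹ := by
  rw [← centralCommutator_inv, centralCommutator_inv_left, centralCommutator_inv]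

/-- `(a z) ∘ₙ (b w) = a b · z w [a,b]ⁿ` for central `z`, `w`. -/
theorem mul_mul_commutator_zpow_of_center (n : ℤ) (a b : G) (z w : Subgroup.center G) :
    a * z * (b * w) * (a * z * (b * w) * (a * z)⁻¹ * (b * w)⁻¹) ^ n =
      a * b * (z * w * centralCommutator hG a b ^ n : Subgroup.center G) := by
  have key : a * z * (b * w) * (a * z)⁻¹ * (b * w)⁻¹ = (centralCommutator hG a b : G) := by
    change (centralCommutator hG (a * z) (b * w) : G) = _
    simp [centralCommutator_mul_left, centralCommutator_mul_right,
      centralCommutator_center_left, centralCommutator_center_right]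
  rw [key, mul_center_mul]
  push_cast
  rw [Subgroup.mem_center_iff.mp w.2 (z : G)]
  simp only [mul_assoc]

end

/-- For a group of nilpotence class at most two, the operations `g ∘ₙ h = g·h·[g,h]ⁿ`
(`n ∈ ℤ`) form a brace block. -/
theorem stmt_13 {G : Type*} [Group G]
    (hG : commutator G ≤ Subgroup.center G)
    (circ : ℤ → G → G → G)
    (hcirc : ∀ (n : ℤ) (g h : G), circ n g h = g * h * (g * h * g⁻¹ * h⁻¹) ^ n) :
    (∀ n : ℤ,
      (∀ g h k : G, circ n (circ n g h) k = circ n g (circ n h k)) ∧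
      (∀ g : G, circ n 1 g = g ∧ circ n g 1 = g) ∧
      (∀ g : G, circ n g g⁻¹ = 1 ∧ circ n g⁻¹ g = 1)) ∧
    (∀ m n : ℤ, ∀ g h k : G,
      circ n g (circ m h k) = circ m (circ m (circ n g h) g⁻¹) (circ n g k)) := by
  have both : ∀ (n : ℤ) (a b : G) (z w : Subgroup.center G), circ n (a * z) (b * w) =
      a * b * (z * w * centralCommutator hG a b ^ n : Subgroup.center G) := fun n a b z w => by
    rw [hcirc, mul_mul_commutator_zpow_of_center hG]
  have left : ∀ (n : ℤ) (a b : G) (z : Subgroup.center G), circ n (a * z) b =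
      a * b * (z * centralCommutator hG a b ^ n : Subgroup.center G) := fun n a b z => by
    simpa using both n a b z 1
  have right : ∀ (n : ℤ) (a b : G) (w : Subgroup.center G), circ n a (b * w) =
      a * b * (w * centralCommutator hG a b ^ n : Subgroup.center G) := fun n a b w => by
    simpa using both n a b 1 w
  have base : ∀ (n : ℤ) (a b : G), circ n a b =
      a * b * (centralCommutator hG a b ^ n : Subgroup.center G) := fun n a b => by
    simpa using both n a b 1 1
  refine ⟨fun n => ⟨fun g h k => ?_, fun g => ?_, fun g => ?_⟩, fun m n g h k => ?_⟩
  · rw [base n g h, base n h k, left, right, centralCommutator_mul_left,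
      centralCommutator_mul_right, mul_assoc g h k]
    congr 2
    simp only [mul_zpow]
    rw [← mul_assoc, mul_comm]
  · simp [hcirc]
  · simp [hcirc]
  · rw [base m h k, base n g h, base n g k, right, left, both]
    have hprod : g * h * g⁻¹ * (g * k) = g * (h * k) := by group
    rw [hprod]
    congr 2
    simp only [centralCommutator_mul_left, centralCommutator_mul_right,
      centralCommutator_inv_left, centralCommutator_inv_right, centralCommutator_self,
      ← centralCommutator_inv hG g h, mul_zpow, inv_zpow, one_zpow, inv_one, mul_one]
    generalize centralCommutator hG g h = x
    generalize centralCommutator hG g k = y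
    generalize centralCommutator hG h k = u
    apply Additive.ofMul.injective
    simp only [ofMul_mul, ofMul_inv, ofMul_zpow]
    abel
end

section
/- Let G be a group of nilpotence class at most two, i.e. with commutator subgroup [G,G] contained in the center Z(G). For any group endomorphisms ψ, φ of G define g ∘_ψ h = g · ψ(g) · h · ψ(g)⁻¹ and g ∘_φ h = g · φ(g) · h · φ(g)⁻¹. Then (G, ∘_φ, ∘_ψ) is a skew brace: for all g, h, k ∈ G, g ∘_ψ (h ∘_φ k) = ((g ∘_ψ h) ∘_φ ḡ) ∘_φ (g ∘_ψ k), where ḡ = φ(g)⁻¹ · g⁻¹ · φ(g) is the inverse of g with respect to ∘_φ. -/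
open scoped commutatorElement in
/-- In a group of nilpotence class at most two, inner automorphisms commute. -/
theorem MulAut.conj_mul_comm_of_commutator_le_center {G : Type*} [Group G]
    (hG : commutator G ≤ Subgroup.center G) (x y : G) :
    MulAut.conj x * MulAut.conj y = MulAut.conj y * MulAut.conj x := by
  have hc : ⁅x, y⁆ ∈ Subgroup.center G :=
    hG (Subgroup.commutator_mem_commutator (Subgroup.mem_top x) (Subgroup.mem_top y))
  have h1 : MulAut.conj ⁅x, y⁆ = 1 := by
    ext z
    rw [MulAut.conj_apply, ← Subgroup.mem_center_iff.mp hc z, mul_inv_cancel_right,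
      MulAut.one_apply]
  rwa [map_commutatorElement, commutatorElement_eq_one_iff_mul_comm] at h1

/-- In a group of nilpotence class at most two, conjugate elements induce the same inner
automorphism. -/
theorem MulAut.conj_conj_of_commutator_le_center {G : Type*} [Group G]
    (hG : commutator G ≤ Subgroup.center G) (x y : G) :
    MulAut.conj (x * y * x⁻¹) = MulAut.conj y := by
  rw [map_mul, map_mul, map_inv, MulAut.conj_mul_comm_of_commutator_le_center hG x y,
    mul_inv_cancel_right]

/-- For a group of nilpotence class at most two and arbitrary endomorphisms `ψ, φ`,
`(G, ∘_φ, ∘_ψ)` is a skew brace. -/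
theorem stmt_14 {G : Type*} [Group G]
    (hG : commutator G ≤ Subgroup.center G)
    (ψ φ : G →* G)
    (circψ circφ : G → G → G)
    (hcircψ : ∀ g h : G, circψ g h = g * ψ g * h * (ψ g)⁻¹)
    (hcircφ : ∀ g h : G, circφ g h = g * φ g * h * (φ g)⁻¹) :
    (∀ g : G,
      circφ g ((φ g)⁻¹ * g⁻¹ * φ g) = 1 ∧ circφ ((φ g)⁻¹ * g⁻¹ * φ g) g = 1) ∧
    (∀ g h k : G,
      circψ g (circφ h k) =
        circφ (circφ (circψ g h) ((φ g)⁻¹ * g⁻¹ * φ g)) (circψ g k)) := by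
  have comm := MulAut.conj_mul_comm_of_commutator_le_center hG
  have conj_conj := MulAut.conj_conj_of_commutator_le_center hG
  have hφ (g h : G) : circφ g h = g * MulAut.conj (φ g) h := by
    rw [hcircφ, MulAut.conj_apply]; group
  have hψ (g h : G) : circψ g h = g * MulAut.conj (ψ g) h := by
    rw [hcircψ, MulAut.conj_apply]; group
  have conj_φ_conj (x y : G) :
      MulAut.conj (φ (MulAut.conj x y)) = MulAut.conj (φ y) := by
    rw [MulAut.conj_apply, map_mul φ, map_mul φ, map_inv φ, conj_conj]
  have inv_eq (g : G) : (φ g)⁻¹ * g⁻¹ * φ g = MulAut.conj (φ g)⁻¹ g⁻¹ := by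
    rw [MulAut.conj_apply, inv_inv]
  have conj_inv_eq (g : G) : MulAut.conj (φ g) (MulAut.conj (φ g)⁻¹ g⁻¹) = g⁻¹ := by
    rw [← MulAut.mul_apply, ← map_mul, mul_inv_cancel, map_one, MulAut.one_apply]
  simp only [inv_eq]
  refine ⟨fun g => ⟨?_, ?_⟩, fun g h k => ?_⟩
  · rw [hφ, conj_inv_eq, mul_inv_cancel]
  · rw [hφ, conj_φ_conj, map_inv φ, ← map_mul, inv_mul_cancel, map_one]
  · have conj_φ_circψ :
        MulAut.conj (φ (circψ g h)) = MulAut.conj (φ h) * MulAut.conj (φ g) := by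
      rw [hψ, map_mul, map_mul, conj_φ_conj, comm]
    have circφ_inv : circφ (circψ g h) (MulAut.conj (φ g)⁻¹ g⁻¹) =
        circψ g h * MulAut.conj (φ h) g⁻¹ := by
      rw [hφ, conj_φ_circψ, MulAut.mul_apply, conj_inv_eq]
    have conj_φ_circφ :
        MulAut.conj (φ (circψ g h * MulAut.conj (φ h) g⁻¹)) = MulAut.conj (φ h) := by
      rw [map_mul, map_mul, conj_φ_conj, conj_φ_circψ, map_inv, map_inv, mul_inv_cancel_right]
    have conj_comm : MulAut.conj (ψ g) (MulAut.conj (φ h) k) =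
        MulAut.conj (φ h) (MulAut.conj (ψ g) k) := by
      rw [← MulAut.mul_apply, comm, MulAut.mul_apply]
    rw [circφ_inv, hφ _ (circψ g k), conj_φ_circφ, hψ, hψ, hψ, hφ, map_mul, map_mul, conj_comm,
      map_inv]
    group
end

section
/- For each x ∈ R, the map ψₓ : (a,b,c) ↦ (x·a, x·b, x²·c) is a group endomorphism of the Heisenberg group G over R, and the operation g ∘ₓ h = g · ψₓ(g) · h · ψₓ(g)⁻¹ satisfies (a,b,c) ∘ₓ (a',b',c') = (a+a', b+b', c+c'+a·b'+x·(a·b'−a'·b)). Moreover, if x ≠ y then the operations ∘ₓ and ∘ᵧ are distinct: for instance (1,0,0) ∘ₓ (0,1,0) = (1,1,1+x) ≠ (1,1,1+y) = (1,0,0) ∘ᵧ (0,1,0). -/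
/-- The Heisenberg group over a commutative ring `R`. -/
@[ext]
structure Heis (R : Type*) where
  a : R
  b : R
  c : R

namespace Heis

variable {R : Type*} [CommRing R]

instance : Mul (Heis R) :=
  ⟨fun g h => ⟨g.a + h.a, g.b + h.b, g.c + h.c + g.a * h.b⟩⟩

instance : One (Heis R) := ⟨⟨0, 0, 0⟩⟩

instance : Inv (Heis R) := ⟨fun g => ⟨-g.a, -g.b, -g.c + g.a * g.b⟩⟩

theorem mul_def (g h : Heis R) :
    g * h = ⟨g.a + h.a, g.b + h.b, g.c + h.c + g.a * h.b⟩ := rfl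

theorem one_def : (1 : Heis R) = ⟨0, 0, 0⟩ := rfl

theorem inv_def (g : Heis R) : g⁻¹ = ⟨-g.a, -g.b, -g.c + g.a * g.b⟩ := rfl

instance instGroup : Group (Heis R) where
  mul_assoc g h k := by
    simp only [mul_def, Heis.mk.injEq]
    refine ⟨by ring, by ring, by ring⟩
  one_mul g := by
    cases g
    simp only [one_def, mul_def, Heis.mk.injEq]
    refine ⟨by ring, by ring, by ring⟩
  mul_one g := by
    cases g
    simp only [one_def, mul_def, Heis.mk.injEq]
    refine ⟨by ring, by ring, by ring⟩
  inv_mul_cancel g := by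
    simp only [one_def, mul_def, inv_def, Heis.mk.injEq]
    refine ⟨by ring, by ring, by ring⟩

end Heis

/-- Each `ψₓ : (a,b,c) ↦ (xa, xb, x²c)` is an endomorphism of the Heisenberg group, the
corresponding operation `∘ₓ` is given by the stated explicit formula, and distinct `x`
give distinct operations (witnessed by `(1,0,0) ∘ₓ (0,1,0) = (1,1,1+x)`). -/
theorem stmt_16 {R : Type*} [CommRing R]
    (ψ : R → Heis R → Heis R)
    (hψ : ∀ (x : R) (g : Heis R), ψ x g = ⟨x * g.a, x * g.b, x ^ 2 * g.c⟩)
    (circ : R → Heis R → Heis R → Heis R)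
    (hcirc : ∀ (x : R) (g h : Heis R), circ x g h = g * ψ x g * h * (ψ x g)⁻¹) :
    (∀ (x : R) (g h : Heis R), ψ x (g * h) = ψ x g * ψ x h) ∧
    (∀ (x : R) (g h : Heis R),
      circ x g h =
        ⟨g.a + h.a, g.b + h.b, g.c + h.c + g.a * h.b + x * (g.a * h.b - h.a * g.b)⟩) ∧
    (∀ x : R, circ x ⟨1, 0, 0⟩ ⟨0, 1, 0⟩ = ⟨1, 1, 1 + x⟩) ∧
    (∀ x y : R, x ≠ y → circ x ≠ circ y) := by
  have circ_apply (x : R) (g h : Heis R) : circ x g h =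
      ⟨g.a + h.a, g.b + h.b, g.c + h.c + g.a * h.b + x * (g.a * h.b - h.a * g.b)⟩ := by
    simp only [hcirc, hψ, Heis.mul_def, Heis.inv_def, Heis.mk.injEq]
    refine ⟨by ring, by ring, by ring⟩
  have circ_generators (x : R) : circ x ⟨1, 0, 0⟩ ⟨0, 1, 0⟩ = ⟨1, 1, 1 + x⟩ := by
    simp [circ_apply]
  refine ⟨fun x g h => ?_, circ_apply, circ_generators, fun x y hxy h => hxy ?_⟩
  · simp only [hψ, Heis.mul_def, Heis.mk.injEq]
    refine ⟨by ring, by ring, by ring⟩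
  · have key := congrFun (congrFun h ⟨1, 0, 0⟩) ⟨0, 1, 0⟩
    rw [circ_generators, circ_generators] at key
    exact add_left_cancel (congrArg Heis.c key)
end

section
/- Let p be a prime and G the Heisenberg group over the ring ℤ_p of p-adic integers, endowed with the product topology of ℤ_p × ℤ_p × ℤ_p. The operations g ∘ₙ h := (a+a', b+b', c+c'+a·b'+pⁿ·(a·b'−a'·b)) for g = (a,b,c), h = (a',b',c'), n ∈ ℕ, are pairwise distinct, and they converge to the original operation: for all g, h ∈ G, the sequence (g ∘ₙ h)ₙ∈ℕ converges to g·h as n → ∞. -/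
/-- On the Heisenberg group over the `p`-adic integers (with the product topology), the
operations `g ∘ₙ h` are pairwise distinct and converge to the original operation. -/
theorem stmt_17 (p : ℕ) [Fact p.Prime]
    (circ : ℕ → ℤ_[p] × ℤ_[p] × ℤ_[p] → ℤ_[p] × ℤ_[p] × ℤ_[p] → ℤ_[p] × ℤ_[p] × ℤ_[p])
    (hcirc : ∀ (n : ℕ) (g h : ℤ_[p] × ℤ_[p] × ℤ_[p]),
      circ n g h =
        (g.1 + h.1, g.2.1 + h.2.1,
          g.2.2 + h.2.2 + g.1 * h.2.1 + (p : ℤ_[p]) ^ n * (g.1 * h.2.1 - h.1 * g.2.1))) :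
    (∀ m n : ℕ, m ≠ n → circ m ≠ circ n) ∧
    (∀ g h : ℤ_[p] × ℤ_[p] × ℤ_[p],
      Filter.Tendsto (fun n => circ n g h) Filter.atTop
        (nhds (g.1 + h.1, g.2.1 + h.2.1, g.2.2 + h.2.2 + g.1 * h.2.1))) := by
  refine ⟨fun m n hmn heq => hmn ?_, fun g h => ?_⟩
  · have key := congrFun (congrFun heq (1, 0, 0)) (0, 1, 0)
    have hpow : (p : ℤ_[p]) ^ m = (p : ℤ_[p]) ^ n := by simpa [hcirc] using key
    exact Nat.pow_right_injective (Fact.out : p.Prime).two_le (by exact_mod_cast hpow)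
  · simp only [hcirc]
    have hp : Filter.Tendsto (fun n : ℕ => (p : ℤ_[p]) ^ n) Filter.atTop (nhds 0) :=
      tendsto_pow_atTop_nhds_zero_of_norm_lt_one
        (PadicInt.norm_lt_one_iff_dvd _ |>.mpr dvd_rfl)
    refine tendsto_const_nhds.prodMk_nhds (tendsto_const_nhds.prodMk_nhds ?_)
    simpa using (hp.mul_const (g.1 * h.2.1 - h.1 * g.2.1)).const_add
      (g.2.2 + h.2.2 + g.1 * h.2.1)
end

section
/- Define r : G × G → G × G by r(g,h) = (g · h · ψ↑(h) · g⁻¹ · ψ↑(h)⁻¹ · α(h, g⁻¹), ψ↑(h) · g · ψ↑(h)⁻¹ · α(h,g)). Then r is a non-degenerate set-theoretic solution of the Yang–Baxter equation: r is bijective, (r × id_G) ∘ (id_G × r) ∘ (r × id_G) = (id_G × r) ∘ (r × id_G) ∘ (id_G × r) as maps G × G × G → G × G × G, and writing r(g,h) = (σ_g(h), τ_h(g)), for every x ∈ G the maps σ_x : G → G and τ_x : G → G are bijective. -/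
/-- For an action `T` of `G` on itself by endomorphisms, the map
`(g, h) ↦ (g · h · T_h(g)⁻¹, T_h(g))`, which preserves products. -/
def twistMap {G : Type*} [Group G] (T : G →* Monoid.End G) (p : G × G) : G × G :=
  (p.1 * p.2 * (T p.2 p.1)⁻¹, T p.2 p.1)

section TwistMap

variable {G : Type*} [Group G] {T : G →* Monoid.End G}

theorem endAction_mul_apply (T : G →* Monoid.End G) (h k g : G) :
    T (h * k) g = T h (T k g) := by
  rw [map_mul]
  rfl

theorem endAction_inv_apply_apply (T : G →* Monoid.End G) (h g : G) : T h⁻¹ (T h g) = g := by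
  rw [← endAction_mul_apply, inv_mul_cancel, map_one]
  rfl

theorem endAction_apply_inv_apply (T : G →* Monoid.End G) (h g : G) : T h (T h⁻¹ g) = g := by
  rw [← endAction_mul_apply, mul_inv_cancel, map_one]
  rfl

theorem endAction_conj_eq (hcomm : ∀ g h, T (g * h) = T (h * g)) (g h : G) :
    T (g * h * g⁻¹) = T h := by
  rw [hcomm, inv_mul_cancel_left]

/-- The first component of `twistMap T` acts in the same way as the second argument. -/
theorem endAction_twistMap_fst (hcomm : ∀ g h, T (g * h) = T (h * g))
    (hinv : ∀ g h, T (T h g) = T g) (g h : G) : T (twistMap T (g, h)).1 = T h := by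
  have key : T (T h g)⁻¹ = T g⁻¹ := by rw [← map_inv, hinv]
  rw [twistMap, map_mul, key, ← map_mul, endAction_conj_eq hcomm]

theorem twistMap_bijective (hcomm : ∀ g h, T (g * h) = T (h * g))
    (hinv : ∀ g h, T (T h g) = T g) : Function.Bijective (twistMap T) := by
  refine ⟨?_, ?_⟩
  · rintro ⟨g, h⟩ ⟨g', h'⟩ heq
    have hT : T h = T h' := by
      rw [← endAction_twistMap_fst hcomm hinv g h, heq, endAction_twistMap_fst hcomm hinv]
    obtain ⟨h₁, h₂⟩ := Prod.ext_iff.1 heq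
    simp only [twistMap] at h₁ h₂
    have hg : g = g' := by
      rw [← endAction_inv_apply_apply T h g, h₂, ← hT, endAction_inv_apply_apply]
    subst hg
    rw [h₂] at h₁
    rw [mul_left_cancel (mul_right_cancel h₁)]
  · rintro ⟨u, v⟩
    set g := T u⁻¹ v with hg
    have hT : T (g⁻¹ * u * v) = T u := by
      have key : T g⁻¹ = T v⁻¹ := by rw [hg, ← map_inv, hinv]
      rw [map_mul, map_mul, key, ← map_mul, ← map_mul, hcomm, ← mul_assoc, mul_inv_cancel, one_mul]
    refine ⟨(g, g⁻¹ * u * v), ?_⟩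
    simp only [twistMap, hT]
    rw [hg, endAction_apply_inv_apply]
    refine Prod.ext ?_ rfl
    group

theorem twistMap_fst_bijective (hcomm : ∀ g h, T (g * h) = T (h * g))
    (hinv : ∀ g h, T (T h g) = T g) (g : G) :
    Function.Bijective fun h => (twistMap T (g, h)).1 := by
  refine ⟨fun h h' heq => ?_, fun w => ?_⟩
  · have hT : T h = T h' := by
      rw [← endAction_twistMap_fst hcomm hinv g h, ← endAction_twistMap_fst hcomm hinv g h']
      exact congrArg T heq
    simp only [twistMap, hT] at heq
    exact mul_left_cancel (mul_right_cancel heq)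
  · have hT : T (g⁻¹ * w * T w g) = T w := by
      rw [map_mul, hinv, ← map_mul, hcomm, ← mul_assoc, mul_inv_cancel, one_mul]
    refine ⟨g⁻¹ * w * T w g, ?_⟩
    simp only [twistMap, hT]
    group

theorem twistMap_snd_bijective (T : G →* Monoid.End G) (h : G) :
    Function.Bijective fun g => (twistMap T (g, h)).2 :=
  Function.bijective_iff_has_inverse.2
    ⟨T h⁻¹, endAction_inv_apply_apply T h, endAction_apply_inv_apply T h⟩

/-- The Yang–Baxter equation for `twistMap T`. -/
theorem twistMap_yangBaxter (hcomm : ∀ g h, T (g * h) = T (h * g))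
    (hinv : ∀ g h, T (T h g) = T g) (rl rr : G × G × G → G × G × G)
    (hrl : ∀ x y z, rl (x, y, z) = ((twistMap T (x, y)).1, (twistMap T (x, y)).2, z))
    (hrr : ∀ x y z, rr (x, y, z) = (x, (twistMap T (y, z)).1, (twistMap T (y, z)).2)) :
    rl ∘ rr ∘ rl = rr ∘ rl ∘ rr := by
  have hfst : ∀ g h, T (g * h * (T h g)⁻¹) = T h := endAction_twistMap_fst hcomm hinv
  have hswap : ∀ y z x, T y (T z x) = T z (T y x) := fun y z x => by
    rw [← endAction_mul_apply, hcomm, endAction_mul_apply]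
  funext ⟨x, y, z⟩
  simp only [Function.comp_apply, hrl, hrr, twistMap, hfst, hinv, map_mul, map_inv, hswap y z]
  refine Prod.ext ?_ rfl
  group

end TwistMap

/-- The map `r(g,h) = (g·h·ψ↑(h)·g⁻¹·ψ↑(h)⁻¹·α(h,g⁻¹), ψ↑(h)·g·ψ↑(h)⁻¹·α(h,g))` is a
non-degenerate set-theoretic solution of the Yang–Baxter equation. -/
theorem stmt_18
    {G : Type*} [Group G] (K A : Subgroup G) [K.Normal]
    (hKZ : K ≤ Subgroup.center G) (hKA : K ≤ A)
    (hAK : ∀ a ∈ A, ∀ b ∈ A, a * b * a⁻¹ * b⁻¹ ∈ K)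
    (ψ : G ⧸ K →* G ⧸ K)
    (hψA : ∀ x : G ⧸ K, ψ x ∈ Subgroup.map (QuotientGroup.mk' K) A)
    (l : G → G) (hlA : ∀ g, l g ∈ A)
    (hl : ∀ g : G, (QuotientGroup.mk (l g) : G ⧸ K) = ψ (QuotientGroup.mk g))
    (α : G → G → G) (hαK : ∀ g h, α g h ∈ K)
    (hαmul₁ : ∀ g h k : G, α (g * h) k = α g k * α h k)
    (hαmul₂ : ∀ g h k : G, α g (h * k) = α g h * α g k)
    (hαK₁ : ∀ g : G, ∀ k ∈ K, α k g = 1)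
    (hαK₂ : ∀ g : G, ∀ k ∈ K, α g k = 1)
    (r : G × G → G × G)
    (hr : ∀ g h : G,
      r (g, h) =
        (g * h * l h * g⁻¹ * (l h)⁻¹ * α h (g⁻¹), l h * g * (l h)⁻¹ * α h g))
    (rl rr : G × G × G → G × G × G)
    (hrl : ∀ x y z : G, rl (x, y, z) = ((r (x, y)).1, (r (x, y)).2, z))
    (hrr : ∀ x y z : G, rr (x, y, z) = (x, (r (y, z)).1, (r (y, z)).2)) :
    Function.Bijective r ∧
    rl ∘ rr ∘ rl = rr ∘ rl ∘ rr ∧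
    (∀ x : G, Function.Bijective fun y : G => (r (x, y)).1) ∧
    (∀ x : G, Function.Bijective fun y : G => (r (y, x)).2) := by
  have hcen : ∀ k ∈ K, ∀ g, g * k = k * g := fun k hk => Subgroup.mem_center_iff.1 (hKZ hk)
  have hα₁ : ∀ g, α 1 g = 1 := fun g => hαK₁ g 1 K.one_mem
  have hα₂ : ∀ g, α g 1 = 1 := fun g => hαK₂ g 1 K.one_mem
  have hαcomm : ∀ a b c d, α a b * α c d = α c d * α a b := fun a b c d =>
    hcen _ (hαK c d) _
  have hαconj₁ : ∀ a g x, α (a * g * a⁻¹) x = α g x := fun a g x => by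
    rw [hαmul₁, hαmul₁, hαcomm a, mul_assoc, ← hαmul₁, mul_inv_cancel, hα₁, mul_one]
  have hαconj₂ : ∀ a g x, α x (a * g * a⁻¹) = α x g := fun a g x => by
    rw [hαmul₂, hαmul₂, hαcomm x a, mul_assoc, ← hαmul₂, mul_inv_cancel, hα₂, mul_one]
  have hconj : ∀ a b : G, (a : G ⧸ K) = b → ∀ g, a * g * a⁻¹ = b * g * b⁻¹ := by
    intro a b hab g
    obtain ⟨k, hk, rfl⟩ : ∃ k ∈ K, b = a * k := ⟨a⁻¹ * b, QuotientGroup.eq.1 hab, by group⟩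
    rw [mul_assoc a k g, ← hcen k hk g]
    group
  have hψcomm : ∀ x y : G ⧸ K, ψ (x * y) = ψ (y * x) := by
    intro x y
    obtain ⟨a, ha, hax⟩ := hψA x
    obtain ⟨b, hb, hby⟩ := hψA y
    rw [map_mul, map_mul, ← hax, ← hby, ← map_mul, ← map_mul]
    refine (QuotientGroup.eq.2 ?_).symm
    have h := hAK _ (A.inv_mem ha) _ (A.inv_mem hb)
    rwa [inv_inv, inv_inv, ← mul_inv_rev b a, mul_assoc] at h
  let T : G →* Monoid.End G :=
    { toFun := fun h =>
        { toFun := fun g => l h * g * (l h)⁻¹ * α h g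
          map_one' := by simp [hα₂]
          map_mul' := fun g g' => by
            have := hcen _ (hαK h g) (l h * g' * (l h)⁻¹)
            rw [hαmul₂, mul_assoc _ (α h g), ← mul_assoc (α h g) (l h * g' * (l h)⁻¹), ← this]
            group }
      map_one' := by
        ext g
        have h1 := hconj (l 1) 1 (by rw [hl, QuotientGroup.mk_one, map_one]) g
        change l 1 * g * (l 1)⁻¹ * α 1 g = g
        simpa [hα₁] using h1
      map_mul' := fun h h' => by
        ext g
        have h1 := hconj (l (h * h')) (l h * l h')
          (by rw [hl, QuotientGroup.mk_mul, QuotientGroup.mk_mul, map_mul, hl, hl]) g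
        change l (h * h') * g * (l (h * h'))⁻¹ * α (h * h') g =
          l h * (l h' * g * (l h')⁻¹ * α h' g) * (l h)⁻¹ *
            α h (l h' * g * (l h')⁻¹ * α h' g)
        rw [h1, hαmul₂ h _ (α h' g), hαK₂ _ _ (hαK h' g), hαconj₂, hαmul₁, hαcomm h,
          mul_assoc (l h) _ (l h)⁻¹, mul_assoc _ (α h' g) (l h)⁻¹, ← hcen _ (hαK h' g) (l h)⁻¹]
        group }
  have hT : ∀ h g, T h g = l h * g * (l h)⁻¹ * α h g := fun _ _ => rfl
  have hText : ∀ h h' : G, ψ h = ψ h' → (∀ g, α h g = α h' g) → T h = T h' := by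
    intro h h' hψ hα
    ext g
    rw [hT, hT, hα, hconj (l h) (l h') (by rw [hl, hl, hψ])]
  have hcomm : ∀ g h, T (g * h) = T (h * g) := fun g h =>
    hText _ _ (by rw [QuotientGroup.mk_mul, QuotientGroup.mk_mul, hψcomm])
      fun x => by rw [hαmul₁, hαmul₁, hαcomm]
  have hinv : ∀ g h, T (T h g) = T g := by
    refine fun g h => hText _ _ ?_ fun x => ?_
    · rw [hT, QuotientGroup.mk_mul_of_mem _ (hαK h g), QuotientGroup.mk_mul, hψcomm,
        ← QuotientGroup.mk_mul, inv_mul_cancel_left]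
    · rw [hT, hαmul₁, hαK₁ _ _ (hαK h g), mul_one, hαconj₁]
  obtain rfl : r = twistMap T := by
    funext ⟨g, h⟩
    rw [hr, twistMap, ← map_inv, hT, hT]
    refine Prod.ext ?_ rfl
    group
  exact ⟨twistMap_bijective hcomm hinv, twistMap_yangBaxter hcomm hinv rl rr hrl hrr,
    twistMap_fst_bijective hcomm hinv, twistMap_snd_bijective T⟩
end

section
/- Let G be a set carrying two group structures (G, ∘₁) and (G, ∘₂) with the same identity element 1; write ḡ⁽¹⁾ and ḡ⁽²⁾ for the inverse of g with respect to ∘₁ and ∘₂ respectively. Then (G, ∘₁, ∘₂) is a skew brace, i.e. g ∘₂ (h ∘₁ k) = ((g ∘₂ h) ∘₁ ḡ⁽¹⁾) ∘₁ (g ∘₂ k) for all g, h, k ∈ G, if and only if the image of the left regular representation of (G, ∘₂) normalises that of (G, ∘₁) in the symmetric group on G, i.e. for all g, h ∈ G there exists k ∈ G such that for all x ∈ G, g ∘₂ (h ∘₁ (ḡ⁽²⁾ ∘₂ x)) = k ∘₁ x. -/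
/-- For two group operations on `G` with the same identity, `(G, ∘₁, ∘₂)` is a skew brace
if and only if the image of the left regular representation of `(G, ∘₂)` normalises that
of `(G, ∘₁)` in the symmetric group on `G`. -/
theorem stmt_19 {G : Type*} [Nonempty G]
    (op₁ op₂ : G → G → G) (one : G) (inv₁ inv₂ : G → G)
    (hassoc₁ : ∀ a b c : G, op₁ (op₁ a b) c = op₁ a (op₁ b c))
    (hone₁ : ∀ a : G, op₁ one a = a ∧ op₁ a one = a)
    (hinv₁ : ∀ a : G, op₁ a (inv₁ a) = one ∧ op₁ (inv₁ a) a = one)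
    (hassoc₂ : ∀ a b c : G, op₂ (op₂ a b) c = op₂ a (op₂ b c))
    (hone₂ : ∀ a : G, op₂ one a = a ∧ op₂ a one = a)
    (hinv₂ : ∀ a : G, op₂ a (inv₂ a) = one ∧ op₂ (inv₂ a) a = one) :
    (∀ g h k : G,
        op₂ g (op₁ h k) = op₁ (op₁ (op₂ g h) (inv₁ g)) (op₂ g k)) ↔
    (∀ g h : G, ∃ k : G, ∀ x : G,
        op₂ g (op₁ h (op₂ (inv₂ g) x)) = op₁ k x) := by
  constructor
  · intro hbrace g h
    refine ⟨op₁ (op₂ g h) (inv₁ g), fun x => ?_⟩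
    rw [hbrace, ← hassoc₂, (hinv₂ g).1, (hone₂ x).1]
  · intro hnorm g h y
    obtain ⟨k, hk⟩ := hnorm g h
    have hconj : ∀ z, op₂ g (op₁ h z) = op₁ k (op₂ g z) := fun z => by
      rw [← hk, ← hassoc₂ (inv₂ g), (hinv₂ g).2, (hone₂ z).1]
    have hgh : op₂ g h = op₁ k g := by
      simpa only [(hone₁ h).2, (hone₂ g).2] using hconj one
    rw [hconj, hgh, hassoc₁ k, (hinv₁ g).1, (hone₁ k).2]
end
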